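/- Let M be a symmetric real n×n matrix and let 1 ≤ s ≤ n. Suppose that for each j ∈ {1,…,n}, S_j ⊆ {1,…,n} has cardinality s, contains j, and maximizes Σ_{i∈S} M_{i,j}² over all index sets S of cardinality s containing j. Suppose j⋆ ∈ {1,…,n} maximizes Σ_{i∈S_j} M_{i,j}² over j ∈ {1,…,n}. Then for every index set S of cardinality s, ‖M_{S×S}‖_F² ≤ s · ‖M_{S_{j⋆}×S_{j⋆}}‖_F². (That is, this practical algorithm is a head projection for Σ_{(s)} with constant c_H = 1/√s.) -/

import Mathlib

open Matrix Finset MeasureTheory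
open scoped ENNReal NNReal

/-- Frobenius norm of a real `n × n` matrix. -/
noncomputable def frobNorm {n : ℕ} (M : Matrix (Fin n) (Fin n) ℝ) : ℝ :=
  Real.sqrt (∑ i, ∑ j, (M i j) ^ 2)

/-- Frobenius inner product `⟨A, B⟩_F = tr(Aᵀ B)`. -/
def frobInner {n : ℕ} (A B : Matrix (Fin n) (Fin n) ℝ) : ℝ :=
  ∑ i, ∑ j, A i j * B i j

/-- Euclidean (ℓ₂) norm on `ℝ^m`. -/
noncomputable def l2norm {m : ℕ} (y : Fin m → ℝ) : ℝ :=
  Real.sqrt (∑ i, (y i) ^ 2)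

/-- ℓ₁ norm on `ℝ^m`. -/
def l1norm {m : ℕ} (y : Fin m → ℝ) : ℝ := ∑ i, |y i|

/-- `restr M S T` is the matrix equal to `M` on entries `(i,j)` with `i ∈ S`, `j ∈ T`,
and zero elsewhere. -/
def restr {n : ℕ} (M : Matrix (Fin n) (Fin n) ℝ) (S T : Finset (Fin n)) :
    Matrix (Fin n) (Fin n) ℝ :=
  Matrix.of fun i j => if i ∈ S ∧ j ∈ T then M i j else 0

/-- `Σ_{(s)}^{[r]}`: symmetric matrices of rank at most `r` supported on `S × S` for some
index set `S` of cardinality `s`. -/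
def SigmaRS (n r s : ℕ) : Set (Matrix (Fin n) (Fin n) ℝ) :=
  {M | M.IsSymm ∧ M.rank ≤ r ∧ ∃ S : Finset (Fin n), S.card = s ∧ M = restr M S S}

/-- `Y` is a best rank-`r` Frobenius approximation of `A`. -/
noncomputable def IsBestRankApprox {n : ℕ} (r : ℕ) (A Y : Matrix (Fin n) (Fin n) ℝ) : Prop :=
  Y.rank ≤ r ∧
    ∀ Z : Matrix (Fin n) (Fin n) ℝ, Z.rank ≤ r → frobNorm (A - Y) ≤ frobNorm (A - Z)

/-- The squared Frobenius norm of a restriction, summed column by column. -/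
lemma frobNorm_restr_sq {n : ℕ} (M : Matrix (Fin n) (Fin n) ℝ) (S T : Finset (Fin n)) :
    frobNorm (restr M S T) ^ 2 = ∑ j ∈ T, ∑ i ∈ S, (M i j) ^ 2 := by
  have h : ∀ i j, restr M S T i j ^ 2 = if j ∈ T then if i ∈ S then M i j ^ 2 else 0 else 0 := by
    intro i j
    by_cases hi : i ∈ S <;> by_cases hj : j ∈ T <;> simp [restr, hi, hj]
  rw [frobNorm, Real.sq_sqrt (by positivity), Finset.sum_comm]
  simp [h, Finset.sum_ite_irrel]

/-- Algorithm 2 is a head projection for `Σ_(s)` with constant `1/√s`. -/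
theorem stmt10 {n s : ℕ} (hs1 : 1 ≤ s) (hsn : s ≤ n)
    (M : Matrix (Fin n) (Fin n) ℝ) (hM : M.IsSymm)
    (Sf : Fin n → Finset (Fin n))
    (hSf : ∀ j, j ∈ Sf j ∧ (Sf j).card = s ∧
      ∀ S : Finset (Fin n), j ∈ S → S.card = s →
        ∑ i ∈ S, (M i j) ^ 2 ≤ ∑ i ∈ Sf j, (M i j) ^ 2)
    (jstar : Fin n)
    (hjstar : ∀ j, ∑ i ∈ Sf j, (M i j) ^ 2 ≤ ∑ i ∈ Sf jstar, (M i jstar) ^ 2) :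
    ∀ S : Finset (Fin n), S.card = s →
      frobNorm (restr M S S) ^ 2 ≤
        s * frobNorm (restr M (Sf jstar) (Sf jstar)) ^ 2 := by
  intro S hS
  rw [frobNorm_restr_sq, frobNorm_restr_sq]
  calc ∑ j ∈ S, ∑ i ∈ S, (M i j) ^ 2
      ≤ S.card • ∑ i ∈ Sf jstar, (M i jstar) ^ 2 :=
        Finset.sum_le_card_nsmul _ _ _ fun j hj => ((hSf j).2.2 S hj hS).trans (hjstar j)
    _ = s * ∑ i ∈ Sf jstar, (M i jstar) ^ 2 := by rw [hS, nsmul_eq_mul]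
    _ ≤ s * ∑ j ∈ Sf jstar, ∑ i ∈ Sf jstar, (M i j) ^ 2 := by
        refine mul_le_mul_of_nonneg_left ?_ s.cast_nonneg
        exact Finset.single_le_sum (f := fun j => ∑ i ∈ Sf jstar, (M i j) ^ 2)
          (fun j _ => by positivity) (hSf jstar).1
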